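/- Let n ≥ 4 be an integer. Assume that K_n(λ) ≥ 0 for every vector λ ∈ ℝ^n with nonnegative entries satisfying 0 < ‖λ‖₂² < n. Then the inequality H_n[λ] ≤ 2·⟨λ, Ψ(n)λ⟩ holds for every nonzero λ ∈ ℝ^n with nonnegative entries. -/

import Mathlib

/-- The `n×n` DFT matrix `(F_n)_{jk} = e^{2πijk/n}`. -/
noncomputable def Fmat (n : ℕ) : Matrix (Fin n) (Fin n) ℂ :=
  fun j k => Complex.exp (2 * Real.pi * Complex.I * (j : ℕ) * (k : ℕ) / n)

/-- `Ψ(n) = (1/n)·F_n·diag(ψ_n(0),…,ψ_n(n−1))·F_n⁻¹` with `ψ_n(k) = min(k, n−k)`. -/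
noncomputable def PsiMat (n : ℕ) : Matrix (Fin n) (Fin n) ℂ :=
  (1 / n : ℂ) • (Fmat n * Matrix.diagonal (fun k : Fin n => ((min k.val (n - k.val) : ℕ) : ℂ)) *
    (Fmat n)⁻¹)

/-- The discrete Laplacian on the `n`-cycle: `(Lλ)_i = 2λ_i − λ_{i+1} − λ_{i−1}` (indices mod `n`). -/
def Lap {R : Type*} [Ring R] {n : ℕ} (l : Fin n → R) : Fin n → R :=
  fun i => 2 * l i - l ⟨(i.val + 1) % n, Nat.mod_lt _ i.pos⟩
    - l ⟨(i.val + (n - 1)) % n, Nat.mod_lt _ i.pos⟩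

/-- `K_n(λ) = 4·⟨λ, LΨ(n)λ⟩ − (2/n)·⟨λ², Lλ⟩` (the first inner product is real since
`Ψ(n)` is a real symmetric matrix; we take the real part). -/
noncomputable def Kfun (n : ℕ) (l : Fin n → ℝ) : ℝ :=
  4 * (∑ j : Fin n, (l j : ℂ) * Lap ((PsiMat n).mulVec fun i => (l i : ℂ)) j).re
    - (2 / n : ℝ) * ∑ j : Fin n, l j ^ 2 * Lap l j

/-- The entropy functional `H_n[λ] = (1/n)·∑_k λ_k²·log(n·λ_k²/‖λ‖₂²)` (`0·log 0 = 0`). -/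
noncomputable def entropyH (n : ℕ) (l : Fin n → ℝ) : ℝ :=
  (1 / n : ℝ) * ∑ k : Fin n, l k ^ 2 * Real.log (n * l k ^ 2 / ∑ j : Fin n, l j ^ 2)

open Finset
open scoped ComplexOrder

lemma hd_sqlog (x : ℝ) : HasDerivAt (fun x : ℝ => x ^ 2 * Real.log (x ^ 2))
    (2 * x * Real.log (x ^ 2) + 2 * x) x := by
  rcases eq_or_ne x 0 with rfl | hx
  · rw [hasDerivAt_iff_tendsto_slope]
    have h : Filter.Tendsto (fun x : ℝ => 2 * (x * Real.log x)) (nhdsWithin 0 {0}ᶜ) (nhds 0) := by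
      have := (Real.continuous_mul_log.const_mul (2:ℝ)).tendsto 0
      simp only [zero_mul, mul_zero] at this
      exact this.mono_left nhdsWithin_le_nhds
    simp only [mul_zero, zero_mul, add_zero]
    refine h.congr' ?_
    filter_upwards [self_mem_nhdsWithin] with y hy
    have hy : y ≠ 0 := hy
    simp only [slope_def_field, Real.log_pow]
    field_simp
    push_cast
    ring
  · have h1 : HasDerivAt (fun x : ℝ => x ^ 2) (2 * x) x := by
      simpa using hasDerivAt_pow 2 x
    have h2 := h1.fun_mul (h1.log (pow_ne_zero 2 hx))
    refine h2.congr_deriv ?_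
    rw [mul_div_cancel₀ _ (pow_ne_zero 2 hx)]

lemma G_anti (m t : ℝ) (ht : t = Real.exp (m / 4)) (hm : m < 0) :
    StrictAntiOn (fun x : ℝ => x * Real.log (x ^ 2) + m * x - t * x ^ 2) (Set.Ici 0) := by
  have hc : ∀ x : ℝ, x * Real.log (x ^ 2) + m * x - t * x ^ 2
      = 2 * (x * Real.log x) + m * x - t * x ^ 2 := by
    intro x; rw [Real.log_pow]; push_cast; ring
  simp only [hc]
  have htp : 0 < t := ht ▸ Real.exp_pos _
  apply strictAntiOn_of_deriv_neg (convex_Ici 0)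
  · have := Real.continuous_mul_log
    fun_prop
  · intro x hx
    rw [interior_Ici] at hx
    have hx : 0 < x := hx
    have h := (((Real.hasDerivAt_mul_log hx.ne').const_mul 2).add
      ((hasDerivAt_id x).const_mul m)).sub ((hasDerivAt_pow 2 x).const_mul t)
    have h' : deriv (fun x : ℝ => 2 * (x * Real.log x) + m * x - t * x ^ 2) x = _ := h.deriv
    rw [h']
    have h1 := Real.log_le_sub_one_of_pos (mul_pos htp hx)
    rw [Real.log_mul htp.ne' hx.ne', ht, Real.log_exp, ← ht] at h1
    norm_num
    nlinarith

lemma Lap_eq {n : ℕ} [NeZero n] (l : Fin n → ℝ) (i : Fin n) :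
    Lap l i = 2 * l i - l (i + 1) - l (i - 1) := by
  have h1 : (⟨(i.val + 1) % n, Nat.mod_lt _ i.pos⟩ : Fin n) = i + 1 := by
    ext; simp [Fin.val_add]
  have h2 : (⟨(i.val + (n - 1)) % n, Nat.mod_lt _ i.pos⟩ : Fin n) = i - 1 := by
    rw [eq_sub_iff_add_eq]
    ext
    have := i.pos
    simp only [Fin.val_add, Fin.val_one', Nat.add_mod_mod, Nat.mod_add_mod]
    rw [show i.val + (n - 1) + 1 = i.val + n by omega, Nat.add_mod_right, Nat.mod_eq_of_lt i.2]
  unfold Lap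
  rw [h1, h2]

lemma sum_Lap_mul {n : ℕ} [NeZero n] (l g : Fin n → ℝ) :
    ∑ i, Lap l i * g i = ∑ i, (l i - l (i + 1)) * (g i - g (i + 1)) := by
  simp only [Lap_eq]
  have e1 : ∑ i, l i * g i = ∑ i, l (i + 1) * g (i + 1) :=
    (Equiv.sum_comp (Equiv.addRight (1 : Fin n)) (fun i => l i * g i)).symm
  have e2 : ∑ i, l (i - 1) * g i = ∑ i, l i * g (i + 1) := by
    rw [← Equiv.sum_comp (Equiv.addRight (1 : Fin n)) (fun i => l (i - 1) * g i)]
    simp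
  have : ∀ i, (2 * l i - l (i + 1) - l (i - 1)) * g i
     = l i * g i + l i * g i - l (i + 1) * g i - l (i - 1) * g i := by intro i; ring
  simp only [this, sum_add_distrib, sum_sub_distrib, e2]
  have : ∀ i, (l i - l (i + 1)) * (g i - g (i + 1))
     = l i * g i + l (i + 1) * g (i + 1) - l (i + 1) * g i - l i * g (i + 1) := by intro i; ring
  simp only [this, sum_add_distrib, sum_sub_distrib]
  rw [← e1]

lemma sum_mul_Lap {n : ℕ} [NeZero n] (l g : Fin n → ℝ) :
    ∑ i, l i * Lap g i = ∑ i, Lap l i * g i := by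
  rw [sum_Lap_mul]
  simp_rw [mul_comm (l _)]
  rw [sum_Lap_mul]
  exact sum_congr rfl fun i _ => mul_comm _ _

lemma Fmat_mul (n : ℕ) (hn : n ≠ 0) : Fmat n * (Fmat n).conjTranspose = (n : ℂ) • 1 := by
  have hp := Complex.isPrimitiveRoot_exp n hn
  set z := Complex.exp (2 * Real.pi * Complex.I / n) with hz
  have hF : ∀ j k, Fmat n j k = (z ^ (j : ℕ)) ^ (k : ℕ) := by
    intro j k
    rw [hz, ← Complex.exp_nat_mul, ← Complex.exp_nat_mul]
    unfold Fmat
    congr 1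
    ring
  have hz1 : ∀ j : ℕ, ‖z ^ j‖ = 1 := by
    intro j; rw [norm_pow, hp.norm'_eq_one hn, one_pow]
  have hz0 : z ≠ 0 := Complex.exp_ne_zero _
  ext j l
  rw [Matrix.mul_apply]
  have : ∀ k, Fmat n j k * (Fmat n).conjTranspose k l = (z ^ (j : ℕ) * (z ^ (l : ℕ))⁻¹) ^ (k : ℕ) := by
    intro k
    rw [Matrix.conjTranspose_apply, hF, hF, mul_pow, star_pow]
    congr 2
    rw [Complex.inv_eq_conj (hz1 l)]
    rfl
  simp only [this]
  rw [Fin.sum_univ_eq_sum_range (fun k => (z ^ (j : ℕ) * (z ^ (l : ℕ))⁻¹) ^ k)]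
  by_cases hjl : j = l
  · subst hjl
    rw [mul_inv_cancel₀ (pow_ne_zero _ hz0)]
    simp
  · have hne : z ^ (j : ℕ) * (z ^ (l : ℕ))⁻¹ ≠ 1 := by
      intro h
      rw [mul_inv_eq_one₀ (pow_ne_zero _ hz0)] at h
      exact hjl (Fin.ext (hp.pow_inj j.2 l.2 h))
    rw [geom_sum_eq hne]
    have : (z ^ (j : ℕ) * (z ^ (l : ℕ))⁻¹) ^ n = 1 := by
      rw [mul_pow, inv_pow, ← pow_mul, ← pow_mul, mul_comm, mul_comm (l : ℕ), pow_mul, mul_comm (j : ℕ), pow_mul,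
        hp.pow_eq_one]
      simp
    rw [this]
    simp [hjl]

lemma Psi_psd (n : ℕ) (hn : n ≠ 0) : (PsiMat n).PosSemidef := by
  have hn' : (n : ℂ) ≠ 0 := by exact_mod_cast hn
  have hinv : (Fmat n)⁻¹ = (1 / n : ℂ) • (Fmat n).conjTranspose := by
    apply Matrix.inv_eq_right_inv
    rw [Matrix.mul_smul, Fmat_mul n hn, smul_smul]
    field_simp
    simp
  have hc : (0 : ℂ) ≤ 1 / n := by
    have : (0 : ℝ) ≤ 1 / n := by positivity
    have h2 : ((0 : ℝ) : ℂ) ≤ ((1 / n : ℝ) : ℂ) := Complex.real_le_real.mpr this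
    simpa using h2
  unfold PsiMat
  rw [hinv, Matrix.mul_smul]
  apply Matrix.PosSemidef.smul _ hc
  apply Matrix.PosSemidef.smul _ hc
  apply Matrix.PosSemidef.mul_mul_conjTranspose_same
  apply Matrix.PosSemidef.diagonal
  intro i
  have : (0 : ℝ) ≤ ((min i.val (n - i.val) : ℕ) : ℝ) := Nat.cast_nonneg _
  have h2 := Complex.real_le_real.mpr this
  simpa using h2

/-- quadratic form -/
noncomputable def Eq' {n : ℕ} (A : Fin n → Fin n → ℝ) (l : Fin n → ℝ) : ℝ :=
  ∑ j, l j * ∑ i, A j i * l i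

lemma sq_log_expand {n : ℕ} (hn : 0 < n) (l : Fin n → ℝ) (hN : 0 < ∑ j, l j ^ 2) :
    entropyH n l = (1 / n : ℝ) * (∑ k, l k ^ 2 * Real.log (l k ^ 2)
      + (∑ j, l j ^ 2) * Real.log n - (∑ j, l j ^ 2) * Real.log (∑ j, l j ^ 2)) := by
  unfold entropyH
  congr 1
  set N := ∑ j, l j ^ 2 with hNd
  rw [show N * Real.log n = ∑ j, l j ^ 2 * Real.log n by rw [hNd, sum_mul],
    show N * Real.log N = ∑ j, l j ^ 2 * Real.log N by rw [← sum_mul],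
    ← sum_add_distrib, ← sum_sub_distrib]
  refine sum_congr rfl fun k _ => ?_
  by_cases h : l k = 0
  · simp [h]
  · have hn' : (n : ℝ) ≠ 0 := by positivity
    rw [Real.log_div (by positivity) hN.ne', Real.log_mul hn' (by positivity)]
    ring

lemma entropy_smul {n : ℕ} (l : Fin n → ℝ) (s : ℝ) (hs : s ≠ 0) :
    entropyH n (fun j => s * l j) = s ^ 2 * entropyH n l := by
  unfold entropyH
  have hN : ∑ j, (s * l j) ^ 2 = s ^ 2 * ∑ j, l j ^ 2 := by
    simp only [mul_pow, ← mul_sum]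
  rw [mul_left_comm (s ^ 2), mul_sum univ _ (s ^ 2)]
  refine congrArg (fun x : ℝ => (1 / n : ℝ) * x) (sum_congr rfl fun k _ => ?_)
  rw [hN, mul_pow, mul_left_comm (n : ℝ), mul_div_mul_left _ _ (pow_ne_zero 2 hs), mul_assoc]

lemma Eq'_smul {n : ℕ} (A : Fin n → Fin n → ℝ) (l : Fin n → ℝ) (s : ℝ) :
    Eq' A (fun j => s * l j) = s ^ 2 * Eq' A l := by
  unfold Eq'
  simp only [mul_left_comm _ s, ← mul_sum]
  rw [mul_sum, mul_sum]
  refine sum_congr rfl fun k _ => ?_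
  ring

/-- derivative of the functional in direction `v` -/
lemma deriv_dir {n : ℕ} (hn : 0 < n) (A : Fin n → Fin n → ℝ) (hA : ∀ i j, A i j = A j i)
    (l v : Fin n → ℝ) (hN : ∑ j, l j ^ 2 = n) (m : ℝ) :
    HasDerivAt (fun t : ℝ => 2 * Eq' A (fun j => l j + t * v j)
      - (1 / n : ℝ) * (∑ k, (l k + t * v k) ^ 2 * Real.log ((l k + t * v k) ^ 2)
      + (∑ j, (l j + t * v j) ^ 2) * Real.log n
      - (∑ j, (l j + t * v j) ^ 2) * Real.log (∑ j, (l j + t * v j) ^ 2))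
      - m / n * ∑ j, (l j + t * v j) ^ 2)
      (∑ k, v k * (4 * ∑ i, A k i * l i - (2 / n) * (l k * Real.log (l k ^ 2) + m * l k))) 0 := by
  have hx : ∀ j, HasDerivAt (fun t : ℝ => l j + t * v j) (v j) 0 := by
    intro j
    simpa using ((hasDerivAt_id (0:ℝ)).mul_const (v j)).const_add (l j)
  have hn0 : (n : ℝ) ≠ 0 := by positivity
  have hS : HasDerivAt (fun t : ℝ => ∑ j, (l j + t * v j) ^ 2) (∑ j, 2 * l j * v j) 0 := by
    apply HasDerivAt.fun_sum
    intro j _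
    simpa using (hx j).fun_pow 2
  have hL : HasDerivAt (fun t : ℝ => ∑ k, (l k + t * v k) ^ 2 * Real.log ((l k + t * v k) ^ 2))
      (∑ k, (2 * l k * Real.log (l k ^ 2) + 2 * l k) * v k) 0 := by
    apply HasDerivAt.fun_sum
    intro j _
    have := hd_sqlog (l j + 0 * v j)
    have := this.comp (0 : ℝ) (hx j)
    simpa [Function.comp_def] using this
  have hE : HasDerivAt (fun t : ℝ => Eq' A (fun j => l j + t * v j))
      (∑ j, (v j * ∑ i, A j i * l i + l j * ∑ i, A j i * v i)) 0 := by
    unfold Eq'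
    apply HasDerivAt.fun_sum
    intro j _
    have h1 : HasDerivAt (fun t : ℝ => ∑ i, A j i * (l i + t * v i)) (∑ i, A j i * v i) 0 := by
      apply HasDerivAt.fun_sum
      intro i _
      exact (hx i).const_mul _
    simpa using (hx j).fun_mul h1
  have hlog := hS.log (by simp [hN, hn0])
  have key := ((hE.const_mul 2).sub (((hL.add (hS.mul_const (Real.log n))).sub
    (hS.mul hlog)).const_mul (1 / n : ℝ))).sub (hS.const_mul (m / n))
  refine key.congr_deriv ?_
  simp only [zero_mul, add_zero, hN]
  have hsym : ∑ j, l j * ∑ i, A j i * v i = ∑ j, v j * ∑ i, A j i * l i := by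
    simp only [mul_sum]
    rw [sum_comm]
    refine sum_congr rfl fun i _ => sum_congr rfl fun j _ => ?_
    rw [hA j i]; ring
  rw [sum_add_distrib, hsym]
  have e1 : ∑ k, (2 * l k * Real.log (l k ^ 2) + 2 * l k) * v k
      = 2 * (∑ k, v k * (l k * Real.log (l k ^ 2))) + ∑ j, 2 * l j * v j := by
    rw [mul_sum, ← sum_add_distrib]
    exact sum_congr rfl fun k _ => by ring
  have e2 : ∑ j, 2 * l j * v j = 2 * ∑ j, v j * l j := by
    rw [mul_sum]; exact sum_congr rfl fun k _ => by ring
  have e3 : ∑ k, v k * (4 * ∑ i, A k i * l i - (2 / n) * (l k * Real.log (l k ^ 2) + m * l k))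
     = 4 * (∑ j, v j * ∑ i, A j i * l i) - 2 / n * (∑ k, v k * (l k * Real.log (l k ^ 2)))
       - 2 / n * m * ∑ j, v j * l j := by
    rw [mul_sum, mul_sum, mul_sum, ← sum_sub_distrib, ← sum_sub_distrib]
    exact sum_congr rfl fun k _ => by ring
  rw [e3, e1, e2]
  field_simp
  ring

lemma core (n : ℕ) (hn : 0 < n) (A : Fin n → Fin n → ℝ) (hA : ∀ i j, A i j = A j i)
    (hpos : ∀ l, 0 ≤ Eq' A l)
    (hK : ∀ l : Fin n → ℝ, (∀ j, 0 ≤ l j) → 0 < ∑ j : Fin n, l j ^ 2 →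
      (∑ j : Fin n, l j ^ 2) < n →
      0 ≤ 4 * ∑ j, Lap l j * (∑ i, A j i * l i) - (2 / n : ℝ) * ∑ j : Fin n, l j ^ 2 * Lap l j) :
    ∀ l : Fin n → ℝ, (∀ j, 0 ≤ l j) → l ≠ 0 → entropyH n l ≤ 2 * Eq' A l := by
  have : NeZero n := ⟨hn.ne'⟩
  have hn0 : (0 : ℝ) < n := by exact_mod_cast hn
  have hNpos : ∀ l : Fin n → ℝ, l ≠ 0 → 0 < ∑ j, l j ^ 2 := by
    intro l hl
    obtain ⟨k, hk⟩ := Function.ne_iff.mp hl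
    have hk : l k ≠ 0 := hk
    exact sum_pos' (fun _ _ => sq_nonneg _) ⟨k, mem_univ _, by positivity⟩
  let S : Set (Fin n → ℝ) := {l | (∀ j, 0 ≤ l j) ∧ ∑ j, l j ^ 2 = n}
  have hSc : IsCompact S := by
    apply Metric.isCompact_of_isClosed_isBounded
    · apply IsClosed.and
      · simp only [Set.ofPred_forall]
        exact isClosed_iInter fun j => isClosed_le continuous_const (continuous_apply j)
      · exact isClosed_eq (by fun_prop) continuous_const
    · apply (Metric.isBounded_Icc (0 : Fin n → ℝ) (fun _ => (n : ℝ))).subset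
      intro l hl
      refine ⟨fun j => hl.1 j, fun j => ?_⟩
      have h1 : l j ^ 2 ≤ n := hl.2 ▸ single_le_sum (f := fun j => l j ^ 2)
        (fun _ _ => sq_nonneg _) (mem_univ j)
      have h2 : (1 : ℝ) ≤ n := by exact_mod_cast hn
      have h3 := hl.1 j
      show l j ≤ n
      nlinarith
  have hSn : S.Nonempty := ⟨fun _ => 1, by intro j; norm_num, by simp⟩
  let f : (Fin n → ℝ) → ℝ := fun l => 2 * Eq' A l - (1 / n : ℝ) * ∑ k, l k ^ 2 * Real.log (l k ^ 2)
  have hfc : Continuous f := by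
    have h0 : Continuous (fun x : ℝ => x ^ 2 * Real.log (x ^ 2)) :=
      continuous_iff_continuousAt.mpr fun x => (hd_sqlog x).continuousAt
    have h1 : ∀ k, Continuous (fun l : Fin n → ℝ => l k ^ 2 * Real.log (l k ^ 2)) :=
      fun k => h0.comp (continuous_apply k)
    apply Continuous.sub
    · unfold Eq'; fun_prop
    · exact (continuous_finsetSum _ fun k _ => h1 k).const_mul _
  obtain ⟨a, haS, hmin⟩ := hSc.exists_isMinOn hSn hfc.continuousOn
  have hfS : ∀ l ∈ S, f l = 2 * Eq' A l - entropyH n l := by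
    intro l hl
    rw [sq_log_expand hn l (hl.2 ▸ hn0), hl.2]
    simp only [f]
    ring
  set m := f a with hm
  -- homogeneous bound
  have hom : ∀ l : Fin n → ℝ, (∀ j, 0 ≤ l j) → l ≠ 0 →
      m / n * ∑ j, l j ^ 2 ≤ 2 * Eq' A l - entropyH n l := by
    intro l hl hl0
    have hN := hNpos l hl0
    set N := ∑ j, l j ^ 2 with hNd
    set s := Real.sqrt (n / N) with hs
    have hsp : 0 < s := Real.sqrt_pos.mpr (by positivity)
    have hs2 : s ^ 2 = n / N := Real.sq_sqrt (by positivity)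
    have hmem : (fun j => s * l j) ∈ S := by
      refine ⟨fun j => mul_nonneg hsp.le (hl j), ?_⟩
      simp only [mul_pow, ← mul_sum]
      rw [← hNd, hs2]
      field_simp
    have h1 : m ≤ f (fun j => s * l j) := hmin hmem
    rw [hfS _ hmem, Eq'_smul, entropy_smul _ _ hsp.ne', hs2] at h1
    have h2 : m ≤ (n / N) * (2 * Eq' A l - entropyH n l) := by linarith
    have h3 := mul_le_mul_of_nonneg_left h2 (show 0 ≤ N / n by positivity)
    have h4 : N / n * (n / N * (2 * Eq' A l - entropyH n l)) = 2 * Eq' A l - entropyH n l := by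
      field_simp
    rw [h4] at h3
    calc m / n * N = N / n * m := by ring
      _ ≤ _ := h3
  rcases le_or_gt 0 m with hm0 | hm0
  · intro l hl hl0
    have h1 := hom l hl hl0
    have h2 : 0 ≤ m / n * ∑ j, l j ^ 2 := mul_nonneg (by positivity) (hNpos l hl0).le
    linarith
  exfalso
  obtain ⟨ha, haN⟩ := haS
  set d : Fin n → ℝ := fun k =>
    4 * ∑ i, A k i * a i - (2 / n) * (a k * Real.log (a k ^ 2) + m * a k) with hd
  -- first order conditions
  have foc : ∀ k, 0 ≤ d k ∧ (0 < a k → d k = 0) := by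
    intro k
    have hder := deriv_dir hn A hA a (Pi.single k 1) haN m
    set φ : ℝ → ℝ := fun t : ℝ => 2 * Eq' A (fun j => a j + t * (Pi.single k 1 : Fin n → ℝ) j)
      - (1 / n : ℝ) * (∑ i, (a i + t * (Pi.single k 1 : Fin n → ℝ) i) ^ 2 * Real.log ((a i + t * (Pi.single k 1 : Fin n → ℝ) i) ^ 2)
      + (∑ j, (a j + t * (Pi.single k 1 : Fin n → ℝ) j) ^ 2) * Real.log n
      - (∑ j, (a j + t * (Pi.single k 1 : Fin n → ℝ) j) ^ 2) * Real.log (∑ j, (a j + t * (Pi.single k 1 : Fin n → ℝ) j) ^ 2))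
      - m / n * ∑ j, (a j + t * (Pi.single k 1 : Fin n → ℝ) j) ^ 2 with hφ
    have hder' : HasDerivAt φ (d k) 0 := by
      refine hder.congr_deriv ?_
      simp [Pi.single_apply, hd]
    have hφ0 : φ 0 = 0 := by
      simp only [hφ, zero_mul, add_zero, haN]
      have : m = 2 * Eq' A a - (1 / n : ℝ) * ∑ k, a k ^ 2 * Real.log (a k ^ 2) := rfl
      rw [div_mul_cancel₀ _ hn0.ne', this]
      ring
    have hφnn : ∀ t, -a k < t → 0 ≤ φ t := by
      intro t ht
      have h0 : ∀ j, 0 ≤ a j + t * (Pi.single k 1 : Fin n → ℝ) j := by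
        intro j
        by_cases h : j = k
        · subst h; simp; linarith
        · simp [h, ha j]
      have h1 : (fun j => a j + t * (Pi.single k 1 : Fin n → ℝ) j) ≠ 0 := by
        intro h
        have := congrFun h k
        simp at this
        linarith
      have h2 := hom _ h0 h1
      rw [sq_log_expand hn _ (hNpos _ h1)] at h2
      simp only [hφ]
      linarith
    constructor
    · have ht := (hasDerivAt_iff_tendsto_slope.mp hder').mono_left
        (nhdsWithin_mono 0 (show Set.Ioi (0:ℝ) ⊆ {0}ᶜ from fun x hx => ne_of_gt hx))
      refine ge_of_tendsto ht ?_
      filter_upwards [self_mem_nhdsWithin] with t ht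
      have ht : 0 < t := ht
      rw [slope_def_field, hφ0]
      have := hφnn t (by linarith [ha k])
      simp only [sub_zero]
      positivity
    · intro hak
      refine IsLocalMin.hasDerivAt_eq_zero ?_ hder'
      filter_upwards [Ioi_mem_nhds (show -a k < 0 by linarith)] with t ht
      rw [hφ0]
      exact hφnn t ht
  set t := Real.exp (m / 4) with ht
  have htp : 0 < t := Real.exp_pos _
  have ht1 : t < 1 := by rw [ht, ← Real.exp_zero]; exact Real.exp_lt_exp.mpr (by linarith)
  have hanti := G_anti m t ht hm0
  set G : ℝ → ℝ := fun x => x * Real.log (x ^ 2) + m * x - t * x ^ 2 with hG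
  have hLd : ∀ i, Lap a i * d i ≤ 0 := by
    intro i
    rcases (ha i).eq_or_lt with h | h
    · apply mul_nonpos_of_nonpos_of_nonneg _ (foc i).1
      rw [Lap_eq, ← h]
      linarith [ha (i+1), ha (i-1)]
    · rw [(foc i).2 h, mul_zero]
  have hterm : ∀ i, (a i - a (i + 1)) * (G (a i) - G (a (i + 1))) ≤ 0 := by
    intro i
    rcases lt_trichotomy (a i) (a (i + 1)) with h | h | h
    · have := hanti (ha i) (ha (i+1)) h
      have : G (a (i + 1)) < G (a i) := this
      nlinarith
    · rw [h]; simp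
    · have := hanti (ha (i+1)) (ha i) h
      have : G (a i) < G (a (i + 1)) := this
      nlinarith
  have hLs : ∀ i, Lap (fun j => t * a j) i = t * Lap a i := by
    intro i; simp only [Lap_eq]; ring
  have hN' : ∑ j, (t * a j) ^ 2 = t ^ 2 * n := by
    simp only [mul_pow, ← mul_sum, haN]
  have hK1 := hK (fun j => t * a j) (fun j => mul_nonneg htp.le (ha j))
    (by rw [hN']; positivity) (by rw [hN']; nlinarith [show t ^ 2 < 1 by nlinarith])
  have hKeq : 4 * ∑ j, Lap (fun j => t * a j) j * (∑ i, A j i * (t * a i))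
      - (2 / n : ℝ) * ∑ j : Fin n, (t * a j) ^ 2 * Lap (fun j => t * a j) j
      = t ^ 2 * (∑ j, Lap a j * d j + 2 / n * ∑ j, Lap a j * G (a j)) := by
    have q : ∀ j, ∑ i, A j i * (t * a i) = t * ∑ i, A j i * a i := by
      intro j; rw [mul_sum]; exact sum_congr rfl fun i _ => by ring
    simp only [hLs, q]
    rw [mul_sum, mul_sum, mul_sum, ← sum_sub_distrib, ← sum_add_distrib, mul_sum]
    refine sum_congr rfl fun j _ => ?_
    simp only [hd, hG]
    ring
  rw [hKeq, sum_Lap_mul a (fun j => G (a j))] at hK1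
  have hs1 : ∑ j, Lap a j * d j ≤ 0 := sum_nonpos fun i _ => hLd i
  have hs2 : 0 ≤ ∑ i, (a i - a (i + 1)) * (G (a i) - G (a (i + 1))) := by
    have h1 := nonneg_of_mul_nonneg_right hK1 (by positivity)
    have h2 : 0 ≤ 2 / n * ∑ i, (a i - a (i + 1)) * (G (a i) - G (a (i + 1))) := by linarith
    exact nonneg_of_mul_nonneg_right h2 (by positivity)
  have hs3 : ∑ i, (a i - a (i + 1)) * (G (a i) - G (a (i + 1))) = 0 :=
    le_antisymm (sum_nonpos fun i _ => hterm i) hs2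
  have heach : ∀ i, a i = a (i + 1) := by
    intro i
    have h := (sum_eq_zero_iff_of_nonpos (fun i _ => hterm i)).mp hs3 i (mem_univ i)
    rcases mul_eq_zero.mp h with h | h
    · linarith
    · exact hanti.injOn (ha i) (ha (i+1)) (sub_eq_zero.mp h)
  have hcast : ∀ k : ℕ, a (Fin.ofNat n k) = a 0 := by
    intro k
    induction k with
    | zero => congr 1
    | succ k ih =>
      rw [← ih, heach (Fin.ofNat n k)]
      congr 1
      ext
      simp [Fin.val_add, Fin.ofNat]
  have hconst : ∀ i, a i = a 0 := by
    intro i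
    rw [← hcast i.val]
    congr 1
    ext
    simp [Fin.ofNat, Nat.mod_eq_of_lt i.2]
  have ha1 : a 0 ^ 2 = 1 := by
    simp only [hconst] at haN
    rw [sum_const, card_univ, Fintype.card_fin, nsmul_eq_mul] at haN
    exact mul_left_cancel₀ hn0.ne' (by rw [haN, mul_one])
  have : 0 ≤ m := by
    have h : m = 2 * Eq' A a - (1 / n : ℝ) * ∑ k, a k ^ 2 * Real.log (a k ^ 2) := rfl
    have h2 : ∑ k, a k ^ 2 * Real.log (a k ^ 2) = 0 := by
      apply sum_eq_zero
      intro k _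
      rw [hconst k, ha1]; simp
    rw [h2] at h
    linarith [hpos a]
  linarith

lemma mulVec_re (n : ℕ) (l : Fin n → ℝ) (j : Fin n) :
    ((PsiMat n).mulVec (fun i => (l i : ℂ)) j).re = ∑ i, (PsiMat n j i).re * l i := by
  simp [Matrix.mulVec, dotProduct, Complex.re_sum]

lemma Lap_re {n : ℕ} (g : Fin n → ℂ) (j : Fin n) : (Lap g j).re = Lap (fun i => (g i).re) j := by
  simp [Lap]

theorem Kn_nonneg_implies_LSI (n : ℕ) (hn : 4 ≤ n)
    (hK : ∀ l : Fin n → ℝ, (∀ j, 0 ≤ l j) → 0 < ∑ j : Fin n, l j ^ 2 →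
      (∑ j : Fin n, l j ^ 2) < n → 0 ≤ Kfun n l) :
    ∀ l : Fin n → ℝ, (∀ j, 0 ≤ l j) → l ≠ 0 →
      entropyH n l ≤
        2 * (∑ j : Fin n, (l j : ℂ) * (PsiMat n).mulVec (fun i => (l i : ℂ)) j).re := by
  have hn0 : n ≠ 0 := by omega
  have : NeZero n := ⟨hn0⟩
  have hpsd := Psi_psd n hn0
  have hE : ∀ l : Fin n → ℝ, (∑ j : Fin n, (l j : ℂ) * (PsiMat n).mulVec (fun i => (l i : ℂ)) j).re
      = Eq' (fun j i => (PsiMat n j i).re) l := by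
    intro l
    simp only [Complex.re_sum, Complex.re_ofReal_mul, mulVec_re]
    rfl
  intro l hl hl0
  rw [hE]
  refine core n (by omega) _ ?_ ?_ ?_ l hl hl0
  · intro i j
    have := hpsd.1.apply i j
    show (PsiMat n i j).re = (PsiMat n j i).re
    rw [← this]
    simp
  · intro l
    rw [← hE]
    have h := hpsd.re_dotProduct_nonneg (fun i => (l i : ℂ))
    simpa [dotProduct] using h
  · intro l hl h0 h1
    have h := hK l hl h0 h1
    unfold Kfun at h
    simp only [Complex.re_sum, Complex.re_ofReal_mul, Lap_re, mulVec_re] at h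
    rwa [sum_mul_Lap] at h
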